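/- The mixture p-to-e calibrator: identity and admissibility. For every real p ∈ (0,1), ∫_0^1 κ p^{κ−1} dκ = (1 − p + p·log p) / (p (log p)²), so the function C_mix defined by C_mix(p) := (1 − p + p·log p)/(p (log p)²) for p ∈ (0,1), C_mix(0) := ∞, and C_mix(1) := 1/2 is the mixture over κ ∈ (0,1) of the functions C_κ(p) = κ p^{κ−1}. Moreover ∫_0^1 C_mix(p) dp = 1 (each C_κ with κ ∈ (0,1) satisfies ∫_0^1 κ p^{κ−1} dp = 1), so C_mix is an admissible p-to-e calibrator. -/

import Mathlib

open MeasureTheory Filter Set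
open scoped ENNReal NNReal

namespace SAVI

variable {Ω : Type*}

/-- A stopping time with values in `ℕ ∪ {∞}` with respect to the filtration `G`:
`{τ ≤ t}` is `G t`-measurable for every `t : ℕ`. -/
def IsEStop [mΩ : MeasurableSpace Ω] (G : Filtration ℕ mΩ) (τ : Ω → WithTop ℕ) : Prop :=
  ∀ t : ℕ, MeasurableSet[G t] {ω | τ ω ≤ (t : WithTop ℕ)}

/-- The value of an `ℝ≥0∞`-valued process at an extended stopping time,
interpreted as `limsup_t e t` on the event `{τ = ∞}`. -/
noncomputable def stopVal (e : ℕ → Ω → ℝ≥0∞) (τ : Ω → WithTop ℕ) (ω : Ω) : ℝ≥0∞ :=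
  if h : τ ω = ⊤ then Filter.limsup (fun t => e t ω) Filter.atTop
  else e ((τ ω).untop h) ω

/-- The running maximum `e_t^* = max_{i ≤ t} e_i` of an `ℝ≥0∞`-valued process. -/
noncomputable def runMax (e : ℕ → Ω → ℝ≥0∞) (t : ℕ) (ω : Ω) : ℝ≥0∞ :=
  (Finset.range (t + 1)).sup fun i => e i ω

/-- The event `ξ_τ` obtained by stopping an adapted sequence of events `ξ` at an extended
stopping time `τ`, with `ξ_∞ = limsup_t ξ_t` on `{τ = ∞}`. -/
def stopEventSet (ξ : ℕ → Set Ω) (τ : Ω → WithTop ℕ) : Set Ω :=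
  {ω | (∃ t : ℕ, τ ω = (t : WithTop ℕ) ∧ ω ∈ ξ t) ∨
    (τ ω = ⊤ ∧ ω ∈ Filter.limsup ξ Filter.atTop)}

/-- The event `{p_τ ≤ α}` for a `[0,1]`-valued process `p` stopped at `τ`, interpreted as
`limsup_t {p_t ≤ α}` on `{τ = ∞}`. -/
def stopEventP (p : ℕ → Ω → ℝ) (τ : Ω → WithTop ℕ) (α : ℝ) : Set Ω :=
  {ω | (∃ t : ℕ, τ ω = (t : WithTop ℕ) ∧ p t ω ≤ α) ∨
    (τ ω = ⊤ ∧ ω ∈ Filter.limsup (fun t => {ω' | p t ω' ≤ α}) Filter.atTop)}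

/-- An e-process for the family `𝒩` (composite null) in the filtration `G`: a `G`-adapted
`[0,∞]`-valued process with `e_0 ≤ 1` and `E_P[e_τ] ≤ 1` for every `G`-stopping time `τ`
and every `P ∈ 𝒩`. -/
def IsEProcess [mΩ : MeasurableSpace Ω] (G : Filtration ℕ mΩ) (𝒩 : Set (Measure Ω))
    (e : ℕ → Ω → ℝ≥0∞) : Prop :=
  (∀ t, Measurable[G t] (e t)) ∧ (∀ ω, e 0 ω ≤ 1) ∧
    ∀ τ : Ω → WithTop ℕ, IsEStop G τ → ∀ P ∈ 𝒩, ∫⁻ ω, stopVal e τ ω ∂P ≤ 1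

/-- A p-process for the family `𝒩` in the filtration `G`: a `G`-adapted `[0,1]`-valued
process with `P(p_τ ≤ α) ≤ α` for every `G`-stopping time `τ`, `P ∈ 𝒩`, `α ∈ (0,1)`. -/
def IsPProcess [mΩ : MeasurableSpace Ω] (G : Filtration ℕ mΩ) (𝒩 : Set (Measure Ω))
    (p : ℕ → Ω → ℝ) : Prop :=
  (∀ t, Measurable[G t] (p t)) ∧ (∀ t ω, p t ω ∈ Set.Icc (0 : ℝ) 1) ∧
    ∀ τ : Ω → WithTop ℕ, IsEStop G τ → ∀ P ∈ 𝒩, ∀ α ∈ Set.Ioo (0 : ℝ) 1,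
      P (stopEventP p τ α) ≤ ENNReal.ofReal α

/-- An adjuster: an increasing function `A : [1,∞] → [0,∞]` with `∫_1^∞ A(x)/x² dx ≤ 1`. -/
def IsAdjuster (A : ℝ≥0∞ → ℝ≥0∞) : Prop :=
  MonotoneOn A (Set.Ici 1) ∧
    ∫⁻ x in Set.Ioi (1 : ℝ), A (ENNReal.ofReal x) / ENNReal.ofReal x ^ 2 ≤ 1

/-- An admissible adjuster: additionally right-continuous, `A(∞) = ∞`, and the integral is 1. -/
def IsAdmissibleAdjuster (A : ℝ≥0∞ → ℝ≥0∞) : Prop :=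
  IsAdjuster A ∧ (∀ x ∈ Set.Ici (1 : ℝ≥0∞), ContinuousWithinAt A (Set.Ici x) x) ∧
    A ⊤ = ⊤ ∧ ∫⁻ x in Set.Ioi (1 : ℝ), A (ENNReal.ofReal x) / ENNReal.ofReal x ^ 2 = 1

/-- A p-to-e calibrator: a decreasing function `C : [0,1] → [0,∞]` with `∫_0^1 C(p) dp ≤ 1`. -/
def IsCalibrator (C : ℝ → ℝ≥0∞) : Prop :=
  AntitoneOn C (Set.Icc 0 1) ∧ ∫⁻ p in Set.Icc (0 : ℝ) 1, C p ≤ 1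

/-- The adjusted process `e_0^adj = 1`, `e_t^adj = A(e_t^*)` for `t ≥ 1`. -/
noncomputable def adjProcess (A : ℝ≥0∞ → ℝ≥0∞) (e : ℕ → Ω → ℝ≥0∞) : ℕ → Ω → ℝ≥0∞ :=
  fun t ω => if t = 0 then 1 else A (runMax e t ω)

/-- A test supermartingale for `P` in `G`: nonnegative, `G`-adapted, `M_0 = 1`, and
`E_P[M_t ∣ G_{t-1}] ≤ M_{t-1}`. -/
def IsTestSupermartingale [mΩ : MeasurableSpace Ω] (G : Filtration ℕ mΩ) (P : Measure Ω)
    (M : ℕ → Ω → ℝ) : Prop :=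
  Supermartingale M G P ∧ (∀ t ω, 0 ≤ M t ω) ∧ ∀ ω, M 0 ω = 1

/-- Running maximum of a real-valued process. -/
noncomputable def runMaxR (M : ℕ → Ω → ℝ) (t : ℕ) (ω : Ω) : ℝ :=
  (Finset.range (t + 1)).sup' (Finset.nonempty_range_iff.mpr t.succ_ne_zero) fun i => M i ω

/-- An e-process for the null `𝒩` is `𝒬`-powerful if `limsup_t e_t = ∞` `Q`-a.s. for every
alternative `Q ∈ 𝒬 \ 𝒩`. -/
def IsQPowerful [mΩ : MeasurableSpace Ω] (𝒩 𝒬 : Set (Measure Ω)) (e : ℕ → Ω → ℝ≥0∞) : Prop :=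
  ∀ Q ∈ 𝒬 \ 𝒩, ∀ᵐ ω ∂Q, Filter.limsup (fun t => e t ω) Filter.atTop = ⊤


/-- The mixture p-to-e calibrator `C_mix(p) = (1 − p + p log p)/(p (log p)²)` for `p ∈ (0,1)`,
with `C_mix(0) = ∞` and `C_mix(1) = 1/2`. -/
noncomputable def Cmix (p : ℝ) : ℝ≥0∞ :=
  if p = 0 then ⊤
  else if p = 1 then ENNReal.ofReal (1 / 2)
  else ENNReal.ofReal ((1 - p + p * Real.log p) / (p * Real.log p ^ 2))

/-- The integrand `κ p^{κ-1}` is continuous in `κ` for fixed `p > 0`. -/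
lemma continuous_mul_rpow_sub_one {p : ℝ} (hp : 0 < p) :
    Continuous fun κ : ℝ => κ * p ^ (κ - 1) :=
  continuous_id.mul (continuous_const.rpow (continuous_id.sub continuous_const)
    fun _ => Or.inl hp.ne')

lemma integral_mul_rpow_sub_one {p : ℝ} (hp : p ∈ Set.Ioo (0 : ℝ) 1) :
    ∫ κ in (0 : ℝ)..1, κ * p ^ (κ - 1)
      = (1 - p + p * Real.log p) / (p * Real.log p ^ 2) := by
  have hp0 : p ≠ 0 := hp.1.ne'
  have hL : Real.log p ≠ 0 := (Real.log_neg hp.1 hp.2).ne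
  have hderiv : ∀ κ ∈ Set.uIcc (0 : ℝ) 1,
      HasDerivAt (fun κ : ℝ => p ^ (κ - 1) * (κ / Real.log p - 1 / Real.log p ^ 2))
        (κ * p ^ (κ - 1)) κ := by
    intro κ _
    have h1 : HasDerivAt (fun κ : ℝ => p ^ (κ - 1)) (Real.log p * 1 * p ^ (κ - 1)) κ :=
      ((hasDerivAt_id κ).sub_const 1).const_rpow hp.1
    have h2 : HasDerivAt (fun κ : ℝ => κ / Real.log p - 1 / Real.log p ^ 2)
        (1 / Real.log p) κ :=
      ((hasDerivAt_id κ).div_const _).sub_const _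
    refine (h1.mul h2).congr_deriv ?_
    field_simp
    ring
  rw [intervalIntegral.integral_eq_sub_of_hasDerivAt hderiv
    ((continuous_mul_rpow_sub_one hp.1).intervalIntegrable _ _)]
  simp only [sub_self, Real.rpow_zero, zero_sub, Real.rpow_neg_one]
  field_simp
  ring

lemma lintegral_mul_rpow_sub_one {κ : ℝ} (hκ : 0 < κ) :
    ∫⁻ p in Set.Icc (0 : ℝ) 1, ENNReal.ofReal (κ * p ^ (κ - 1)) = 1 := by
  have hint : IntervalIntegrable (fun p : ℝ => κ * p ^ (κ - 1)) volume 0 1 :=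
    (intervalIntegral.intervalIntegrable_rpow' (by linarith)).const_mul κ
  rw [setLIntegral_congr Ioc_ae_eq_Icc.symm, ← ofReal_integral_eq_lintegral_ofReal
    ((intervalIntegrable_iff_integrableOn_Ioc_of_le zero_le_one).1 hint),
    ← intervalIntegral.integral_of_le zero_le_one, intervalIntegral.integral_const_mul,
    integral_rpow (Or.inl (by linarith))]
  · simp [hκ.ne']
  · filter_upwards [ae_restrict_mem measurableSet_Ioc] with p hp
    exact mul_nonneg hκ.le (Real.rpow_nonneg hp.1.le _)

lemma Cmix_eq_ofReal_integral {p : ℝ} (hp : p ∈ Set.Ioc (0 : ℝ) 1) :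
    Cmix p = ENNReal.ofReal (∫ κ in (0 : ℝ)..1, κ * p ^ (κ - 1)) := by
  rcases hp.2.eq_or_lt with rfl | h1
  · simp [Cmix]
  · rw [integral_mul_rpow_sub_one ⟨hp.1, h1⟩, Cmix, if_neg hp.1.ne', if_neg h1.ne]

lemma Cmix_eq_lintegral {p : ℝ} (hp : p ∈ Set.Ioc (0 : ℝ) 1) :
    Cmix p = ∫⁻ κ in Set.Ioc (0 : ℝ) 1, ENNReal.ofReal (κ * p ^ (κ - 1)) := by
  rw [Cmix_eq_ofReal_integral hp, intervalIntegral.integral_of_le zero_le_one,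
    ofReal_integral_eq_lintegral_ofReal]
  · exact (intervalIntegrable_iff_integrableOn_Ioc_of_le zero_le_one).1
      ((continuous_mul_rpow_sub_one hp.1).intervalIntegrable _ _)
  · filter_upwards [ae_restrict_mem measurableSet_Ioc] with κ hκ
    exact mul_nonneg hκ.1.le (Real.rpow_nonneg hp.1.le _)

lemma antitoneOn_Cmix : AntitoneOn Cmix (Set.Icc 0 1) := by
  intro p hp q hq hpq
  rcases hp.1.eq_or_lt with rfl | hp0
  · simp [Cmix]
  rw [Cmix_eq_lintegral ⟨hp0, hp.2⟩, Cmix_eq_lintegral ⟨hp0.trans_le hpq, hq.2⟩]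
  refine setLIntegral_mono' measurableSet_Ioc fun κ hκ => ENNReal.ofReal_le_ofReal ?_
  exact mul_le_mul_of_nonneg_left
    (Real.rpow_le_rpow_of_nonpos hp0 hpq (sub_nonpos.2 hκ.2)) hκ.1.le

lemma lintegral_Cmix : ∫⁻ p in Set.Icc (0 : ℝ) 1, Cmix p = 1 := by
  have hmeas : Measurable (Function.uncurry fun p κ : ℝ =>
      ENNReal.ofReal (κ * p ^ (κ - 1))) := by
    unfold Function.uncurry
    fun_prop
  calc ∫⁻ p in Set.Icc (0 : ℝ) 1, Cmix p
      = ∫⁻ p in Set.Ioc (0 : ℝ) 1, Cmix p := setLIntegral_congr Ioc_ae_eq_Icc.symm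
    _ = ∫⁻ p in Set.Ioc (0 : ℝ) 1, ∫⁻ κ in Set.Ioc (0 : ℝ) 1,
          ENNReal.ofReal (κ * p ^ (κ - 1)) :=
        setLIntegral_congr_fun measurableSet_Ioc fun _ hp => Cmix_eq_lintegral hp
    _ = ∫⁻ κ in Set.Ioc (0 : ℝ) 1, ∫⁻ p in Set.Ioc (0 : ℝ) 1,
          ENNReal.ofReal (κ * p ^ (κ - 1)) := lintegral_lintegral_swap hmeas.aemeasurable
    _ = ∫⁻ _ in Set.Ioc (0 : ℝ) 1, 1 :=
        setLIntegral_congr_fun measurableSet_Ioc fun _ hκ =>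
          (setLIntegral_congr Ioc_ae_eq_Icc).trans (lintegral_mul_rpow_sub_one hκ.1)
    _ = 1 := by simp

/-- **The mixture p-to-e calibrator: identity and admissibility.** For every `p ∈ (0,1)`,
`∫_0^1 κ p^{κ−1} dκ = (1 − p + p log p)/(p (log p)²)`, so `C_mix` is the mixture over
`κ ∈ (0,1)` of the calibrators `C_κ(p) = κ p^{κ−1}`. Each `C_κ` satisfies
`∫_0^1 κ p^{κ−1} dp = 1`, `C_mix` is decreasing on `[0,1]`, and `∫_0^1 C_mix(p) dp = 1`, so
`C_mix` is an admissible p-to-e calibrator. -/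
theorem mixture_calibrator_identity_and_admissible :
    (∀ p ∈ Set.Ioo (0 : ℝ) 1,
      ∫ κ in (0 : ℝ)..1, κ * p ^ (κ - 1)
        = (1 - p + p * Real.log p) / (p * Real.log p ^ 2)) ∧
      (∀ κ ∈ Set.Ioo (0 : ℝ) 1,
        ∫⁻ p in Set.Icc (0 : ℝ) 1, ENNReal.ofReal (κ * p ^ (κ - 1)) = 1) ∧
      AntitoneOn Cmix (Set.Icc 0 1) ∧
      ∫⁻ p in Set.Icc (0 : ℝ) 1, Cmix p = 1 :=
  ⟨fun _ hp => integral_mul_rpow_sub_one hp, fun _ hκ => lintegral_mul_rpow_sub_one hκ.1,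
    antitoneOn_Cmix, lintegral_Cmix⟩

end SAVI
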